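/- arXiv:2310.02969 — 2 statements merged into one kernel-verified Lean document; each statement's English description precedes it below -/
import Mathlib

section
/- Let λ, c, p̲, p̄ be real numbers with p̲ < p̄. Define the feasible set F = {(a, b) ∈ ℝ² : a ≥ 0, b ≥ 0, λ + a − b = c} and the objective g(a, b) = p̲·a − p̄·b. If (a*, b*) ∈ F satisfies g(a*, b*) ≥ g(a, b) for all (a, b) ∈ F, then a*·b* = 0. -/
/-- Abstract form of Lemma 1: complementarity of bound duals at a dual-optimal solution. -/
theorem dual_bound_complementarity
    (lam c plo phi : ℝ) (hbnd : plo < phi)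
    (F : Set (ℝ × ℝ))
    (hF : F = {p : ℝ × ℝ | 0 ≤ p.1 ∧ 0 ≤ p.2 ∧ lam + p.1 - p.2 = c})
    (g : ℝ × ℝ → ℝ)
    (hg : ∀ p : ℝ × ℝ, g p = plo * p.1 - phi * p.2)
    (astar bstar : ℝ)
    (hmem : (astar, bstar) ∈ F)
    (hopt : ∀ p ∈ F, g p ≤ g (astar, bstar)) :
    astar * bstar = 0 := by
  subst hF
  obtain ⟨ha, hb, hab⟩ := hmem
  dsimp only at ha hb hab
  have hle := hopt (astar - min astar bstar, bstar - min astar bstar)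
    ⟨sub_nonneg.2 (min_le_left _ _), sub_nonneg.2 (min_le_right _ _), by dsimp only; linarith⟩
  simp only [hg] at hle
  have hmin : min astar bstar ≤ 0 := by
    by_contra! hpos
    linarith [mul_pos (sub_pos.2 hbnd) hpos]
  rcases min_le_iff.1 hmin with h | h
  · simp [le_antisymm h ha]
  · simp [le_antisymm h hb]
end

section
/- Let λ, c, p̲, p̄ be real numbers with p̲ ≤ p̄. Define F = {(a, b) ∈ ℝ² : a ≥ 0, b ≥ 0, λ + a − b = c} and g(a, b) = p̲·a − p̄·b. Then the pair (a*, b*) = (max(0, c − λ), max(0, λ − c)) belongs to F, and for every (a, b) ∈ F one has g(a, b) ≤ g(a*, b*) = p̲·max(0, c − λ) − p̄·max(0, λ − c). -/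
/-- Correctness of the bound-dual recovery step of the dual feasibility completion. -/
theorem dual_bound_recovery
    (lam c plo phi : ℝ) (hbnd : plo ≤ phi)
    (F : Set (ℝ × ℝ))
    (hF : F = {p : ℝ × ℝ | 0 ≤ p.1 ∧ 0 ≤ p.2 ∧ lam + p.1 - p.2 = c})
    (g : ℝ × ℝ → ℝ)
    (hg : ∀ p : ℝ × ℝ, g p = plo * p.1 - phi * p.2) :
    (max 0 (c - lam), max 0 (lam - c)) ∈ F ∧
    (∀ p ∈ F, g p ≤ g (max 0 (c - lam), max 0 (lam - c))) ∧
    g (max 0 (c - lam), max 0 (lam - c)) =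
      plo * max 0 (c - lam) - phi * max 0 (lam - c) := by
  subst hF
  refine ⟨⟨le_max_left _ _, le_max_left _ _, ?_⟩, ?_, hg _⟩
  · rcases le_total lam c with h | h
    · simp [h]
    · simp [h]
  · rintro ⟨a, b⟩ ⟨ha, hb, hab⟩
    dsimp only at ha hb hab
    simp only [hg]
    rcases le_total lam c with h | h
    · rw [max_eq_right (sub_nonneg.2 h), max_eq_left (sub_nonpos.2 h)]
      obtain rfl : a = b + (c - lam) := by linarith
      nlinarith [mul_le_mul_of_nonneg_right hbnd hb]
    · rw [max_eq_left (sub_nonpos.2 h), max_eq_right (sub_nonneg.2 h)]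
      obtain rfl : b = a + (lam - c) := by linarith
      nlinarith [mul_le_mul_of_nonneg_right hbnd ha]
end
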